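/- Let Q be a measure on ℝ with support having left end point μ_inf = a, possessing a point mass at a plus, near a, an absolutely continuous part with density f(x) = (x−a)^{γ−1} g(x) with g analytic and g(a) > 0. Then the left end of the mean-value parameter interval gives a finite contribution to the Jeffreys integral: ∫_a^{μ₀} V(μ)^{-1/2} dμ < ∞. -/

import Mathlib

open scoped ENNReal NNReal
open MeasureTheory Real Set Filter Topology Asymptotics ProbabilityTheory

noncomputable section

/-- Partition function of the exponential family generated by `Q`. -/
def Z (Q : Measure ℝ) (β : ℝ) : ℝ≥0∞ := ∫⁻ x, ENNReal.ofReal (Real.exp (β * x)) ∂Q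

/-- Canonical parameter space. -/
def Γcan (Q : Measure ℝ) : Set ℝ := {β | Z Q β < ⊤}

/-- The member of the exponential family with canonical parameter `β`:
`dP_β/dQ = e^{βx}/Z(β)`. -/
def Pexp (Q : Measure ℝ) (β : ℝ) : Measure ℝ :=
  Q.withDensity (fun x => ENNReal.ofReal (Real.exp (β * x)) / Z Q β)

/-- Log-partition function. -/
def ψ (Q : Measure ℝ) (β : ℝ) : ℝ := Real.log (Z Q β).toReal

open Classical in
/-- Kullback–Leibler divergence (in nats), valued in `ℝ≥0∞`. -/
def KL (P Q' : Measure ℝ) : ℝ≥0∞ :=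
  if P ≪ Q' ∧ Integrable (fun x => Real.log (P.rnDeriv Q' x).toReal) P
  then ENNReal.ofReal (∫ x, Real.log (P.rnDeriv Q' x).toReal ∂P) else ⊤

/-- `Q` is supported on a half-line bounded below (left-truncated family). -/
def LeftTruncated (Q : Measure ℝ) : Prop := ∃ a : ℝ, ∀ᵐ x ∂Q, a ≤ x

lemma aux_hint (Q : Measure ℝ) [IsProbabilityMeasure Q]
    (a : ℝ) (hsupp : Q (Iio a) = 0)
    (γ : ℝ) (hγ : 0 < γ) (g : ℝ → ℝ) (ε : ℝ) (hε : 0 < ε)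
    (hg : ContinuousOn g (Icc a (a + ε)))
    (hdens : Q.restrict (Ioo a (a + ε)) =
      (volume.withDensity
        (fun x => ENNReal.ofReal ((x - a) ^ (γ - 1) * g x))).restrict
          (Ioo a (a + ε))) :
    Integrable (fun x => (x - a) ^ (-(γ / 2))) Q := by
  have hmeas : Measurable (fun x : ℝ => (x - a) ^ (-(γ / 2))) := by fun_prop
  obtain ⟨M, hM⟩ := isCompact_Icc.exists_bound_of_continuousOn hg
  have h1 : IntegrableOn (fun x => (x - a) ^ (-(γ / 2))) (Iio a) Q := by
    rw [IntegrableOn, Measure.restrict_eq_zero.2 hsupp]; exact integrable_zero_measure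
  have h2 : IntegrableOn (fun x => (x - a) ^ (-(γ / 2))) {a} Q := by
    simp
  have h4 : IntegrableOn (fun x => (x - a) ^ (-(γ / 2))) (Ici (a + ε)) Q := by
    refine Measure.integrableOn_of_bounded (M := ε ^ (-(γ / 2))) (measure_ne_top _ _)
      hmeas.aestronglyMeasurable ?_
    refine (ae_restrict_iff' measurableSet_Ici).2 (ae_of_all _ fun x hx => ?_)
    have hx' : a + ε ≤ x := hx
    rw [Real.norm_of_nonneg (Real.rpow_nonneg (by linarith) _)]
    exact Real.rpow_le_rpow_of_nonpos hε (by linarith) (by linarith)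
  have h3 : IntegrableOn (fun x => (x - a) ^ (-(γ / 2))) (Ioo a (a + ε)) Q := by
    have hfm : AEMeasurable (fun x => ENNReal.ofReal ((x - a) ^ (γ - 1) * g x))
        (volume.restrict (Ioo a (a + ε))) := by
      have : AEMeasurable g (volume.restrict (Ioo a (a + ε))) :=
        (hg.mono Ioo_subset_Icc_self).aemeasurable measurableSet_Ioo
      fun_prop
    rw [IntegrableOn, hdens, restrict_withDensity measurableSet_Ioo,
      integrable_withDensity_iff_integrable_smul₀' hfm (by simp)]
    have hI : IntegrableOn (fun x => M * (x - a) ^ (γ / 2 - 1)) (Ioo a (a + ε)) := by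
      have := (intervalIntegral.intervalIntegrable_rpow' (a := 0) (b := ε)
        (r := γ / 2 - 1) (by linarith)).comp_sub_right a
      rw [zero_add, add_comm ε a] at this
      rw [intervalIntegrable_iff_integrableOn_Ioo_of_le (by linarith)] at this
      exact this.const_mul M
    refine hI.mono' ?_ ?_
    · exact hfm.ennreal_toReal.aestronglyMeasurable.smul hmeas.aestronglyMeasurable
    · refine (ae_restrict_iff' measurableSet_Ioo).2 (ae_of_all _ fun x hx => ?_)
      have hxa : 0 < x - a := by linarith [hx.1]
      have hMx := hM x (Ioo_subset_Icc_self hx)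
      have hM0 : 0 ≤ M := (norm_nonneg _).trans hMx
      have e : (x - a) ^ (γ / 2 - 1) = (x - a) ^ (γ - 1) * (x - a) ^ (-(γ / 2)) := by
        rw [← Real.rpow_add hxa]; ring_nf
      rw [e, smul_eq_mul, norm_mul, Real.norm_of_nonneg (ENNReal.toReal_nonneg),
        Real.norm_of_nonneg (Real.rpow_nonneg hxa.le (-(γ / 2))), ← mul_assoc]
      gcongr
      apply ENNReal.toReal_le_of_le_ofReal (by positivity)
      apply ENNReal.ofReal_le_ofReal
      rw [mul_comm]
      gcongr
      exact (le_abs_self _).trans hMx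
  have := ((h1.union h2).union h3).union h4
  rw [← integrableOn_univ]
  refine this.mono_set fun x _ => ?_
  rcases lt_trichotomy x a with h | h | h
  · exact Or.inl (Or.inl (Or.inl h))
  · exact Or.inl (Or.inl (Or.inr h))
  · rcases lt_or_ge x (a + ε) with h' | h'
    · exact Or.inl (Or.inr ⟨h, h'⟩)
    · exact Or.inr h'

lemma aux_canon (Q : Measure ℝ) : Γcan Q = integrableExpSet (fun x => x) Q := by
  ext β
  show (∫⁻ x, ENNReal.ofReal (Real.exp (β * x)) ∂Q) < ⊤ ↔ Integrable (fun x => Real.exp (β * x)) Q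
  rw [← hasFiniteIntegral_iff_ofReal (ae_of_all _ fun x => (Real.exp_pos _).le)]
  exact ⟨fun h => ⟨by fun_prop, h⟩, fun h => h.2⟩

lemma aux_tilt (Q : Measure ℝ) [IsProbabilityMeasure Q] (β : ℝ)
    (h : β ∈ integrableExpSet (fun x => x) Q) :
    Pexp Q β = Q.tilted (fun x => β * x) := by
  have h' : Integrable (fun x => Real.exp (β * x)) Q := h
  rw [Pexp, Measure.tilted]
  congr 1
  ext x
  rw [ENNReal.ofReal_div_of_pos (integral_exp_pos h'), Z,
    ofReal_integral_eq_lintegral_ofReal h' (ae_of_all _ fun x => (Real.exp_pos _).le)]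

lemma aux_neg_mem (Q : Measure ℝ) [IsProbabilityMeasure Q] (a : ℝ) (hsupp : Q (Iio a) = 0)
    (β β₀ : ℝ) (hβ : β ≤ β₀) (h0 : β₀ ∈ interior (integrableExpSet (fun x => x) Q)) :
    β ∈ interior (integrableExpSet (fun x => x) Q) := by
  have hae : ∀ᵐ x ∂Q, a ≤ x := by
    rw [ae_iff]; simpa [Iio, not_le] using hsupp
  rw [mem_interior_iff_mem_nhds, Metric.mem_nhds_iff] at h0 ⊢
  obtain ⟨r, hr, hb⟩ := h0
  refine ⟨r, hr, fun t ht => ?_⟩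
  have ht' : t + (β₀ - β) ∈ integrableExpSet (fun x => x) Q := by
    apply hb
    rw [Metric.mem_ball, Real.dist_eq] at ht ⊢
    convert ht using 2; ring
  have ht'' : Integrable (fun x => Real.exp ((t + (β₀ - β)) * x)) Q := ht'
  show Integrable (fun x => Real.exp (t * x)) Q
  refine (ht''.const_mul (Real.exp (-(β₀ - β) * a))).mono' (by fun_prop) ?_
  filter_upwards [hae] with x hx
  rw [Real.norm_of_nonneg (Real.exp_pos _).le, ← Real.exp_add]
  apply Real.exp_le_exp.2
  nlinarith

/-- density bound using the atom -/
lemma aux_dens (Q : Measure ℝ) [IsProbabilityMeasure Q] (a : ℝ) (hatom : 0 < Q {a}) (β : ℝ)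
    (h : β ∈ integrableExpSet (fun x => x) Q) (x : ℝ) :
    Real.exp (β * x) / (∫ x, Real.exp (β * x) ∂Q) ≤ Real.exp (β * (x - a)) / Q.real {a} := by
  have h' : Integrable (fun x => Real.exp (β * x)) Q := h
  have hq : 0 < Q.real {a} := ENNReal.toReal_pos hatom.ne' (measure_ne_top _ _)
  have h1 : Real.exp (β * a) * Q.real {a} ≤ ∫ x, Real.exp (β * x) ∂Q := by
    have := setIntegral_le_integral (s := {a}) h' (ae_of_all _ fun x => (Real.exp_pos _).le)
    rw [integral_singleton, smul_eq_mul] at this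
    linarith
  calc _ ≤ Real.exp (β * x) / (Real.exp (β * a) * Q.real {a}) := by gcongr
    _ = _ := by
      rw [mul_sub, Real.exp_sub, div_div]

lemma aux_pow (p t : ℝ) (hp : 0 < p) (ht : 0 ≤ t) : t ^ p * Real.exp (-t) ≤ p ^ p := by
  have h1 : t ≤ p * Real.exp (t / p) := by
    have := Real.add_one_le_exp (t / p)
    have h2 : t = p * (t / p) := by field_simp
    have h3 : t / p ≤ Real.exp (t / p) := by linarith
    calc t = p * (t / p) := h2
      _ ≤ _ := by gcongr
  have h2 : t ^ p ≤ p ^ p * Real.exp t := by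
    calc t ^ p ≤ (p * Real.exp (t / p)) ^ p := Real.rpow_le_rpow ht h1 hp.le
      _ = _ := by
        rw [Real.mul_rpow hp.le (Real.exp_pos _).le, ← Real.exp_mul]; field_simp
  rw [Real.exp_neg, ← div_eq_mul_inv, div_le_iff₀ (Real.exp_pos _)]
  exact h2

lemma aux_var (Q : Measure ℝ) [IsProbabilityMeasure Q]
    (a : ℝ) (hsupp : Q (Iio a) = 0) (hatom : 0 < Q {a}) (s : ℝ) (hs : 0 < s)
    (hint : Integrable (fun x => (x - a) ^ (-s)) Q) :
    ∃ C, 0 ≤ C ∧ ∀ β < 0, β ∈ integrableExpSet (fun x => x) Q →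
      variance (fun x => x) (Q.tilted (fun x => β * x)) ≤ C * (-β) ^ (-(2 + s)) := by
  have hae : ∀ᵐ x ∂Q, a ≤ x := by
    rw [ae_iff]; simpa [Iio, not_le] using hsupp
  have hq : 0 < Q.real {a} := ENNReal.toReal_pos hatom.ne' (measure_ne_top _ _)
  have hK : 0 ≤ ∫ x, (x - a) ^ (-s) ∂Q := by
    apply integral_nonneg_of_ae
    filter_upwards [hae] with x hx
    exact Real.rpow_nonneg (by linarith) _
  refine ⟨((2 + s) ^ (2 + s) / Q.real {a}) * ∫ x, (x - a) ^ (-s) ∂Q, by positivity, ?_⟩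
  intro β hβ h
  have h' : Integrable (fun x => Real.exp (β * x)) Q := h
  have := isProbabilityMeasure_tilted h'
  have hb : 0 < -β := by linarith
  rw [← variance_sub_const (by fun_prop) a]
  refine (variance_le_expectation_sq (by fun_prop)).trans ?_
  rw [integral_tilted, mul_right_comm, ← integral_const_mul]
  refine integral_mono_of_nonneg ?_ (hint.const_mul _) ?_
  · refine ae_of_all _ fun x => ?_
    have := integral_exp_pos h'
    simp only [Pi.zero_apply, Pi.pow_apply, smul_eq_mul]
    positivity
  · filter_upwards [hae] with x hx
    simp only [Pi.pow_apply, smul_eq_mul]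
    rcases hx.eq_or_lt with rfl | hx
    · simp [Real.zero_rpow (neg_ne_zero.2 hs.ne')]
    · have hy : 0 < x - a := by linarith
      have e1 := aux_pow (2 + s) (-β * (x - a)) (by linarith) (by positivity)
      rw [Real.mul_rpow hb.le hy.le] at e1
      have e2 : (x - a) ^ 2 = (x - a) ^ (2 + s) * (x - a) ^ (-s) := by
        rw [← Real.rpow_add hy]; simp
      have e3 : (-β) ^ (-(2 + s)) * (-β) ^ (2 + s) = 1 := by
        rw [← Real.rpow_add hb]; simp
      have e4 : -(-β * (x - a)) = β * (x - a) := by ring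
      rw [e4] at e1
      calc _ ≤ Real.exp (β * (x - a)) / Q.real {a} * (x - a) ^ 2 := by
            exact mul_le_mul_of_nonneg_right (aux_dens Q a hatom β h x) (by positivity)
        _ = ((-β) ^ (2 + s) * (x - a) ^ (2 + s) * Real.exp (β * (x - a))) *
            ((-β) ^ (-(2 + s)) * (x - a) ^ (-s) / Q.real {a}) := by
            rw [e2]
            linear_combination (-(Real.exp (β * (x - a)) / Q.real {a} * ((x - a) ^ (2 + s) * (x - a) ^ (-s)))) * e3
        _ ≤ (2 + s) ^ (2 + s) * ((-β) ^ (-(2 + s)) * (x - a) ^ (-s) / Q.real {a}) := by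
            gcongr
        _ = _ := by ring

lemma aux_mean (Q : Measure ℝ) [IsProbabilityMeasure Q]
    (a : ℝ) (hsupp : Q (Iio a) = 0) (hatom : 0 < Q {a})
    (β : ℝ) (hβ : β < 0) (h : β ∈ interior (integrableExpSet (fun x => x) Q)) :
    ∫ x, x ∂(Q.tilted (fun x => β * x)) ≤ a + (Q.real {a})⁻¹ * (-β)⁻¹ := by
  have hae : ∀ᵐ x ∂Q, a ≤ x := by
    rw [ae_iff]; simpa [Iio, not_le] using hsupp
  have hq : 0 < Q.real {a} := ENNReal.toReal_pos hatom.ne' (measure_ne_top _ _)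
  have hh := interior_subset h
  have h' : Integrable (fun x => Real.exp (β * x)) Q := hh
  have := isProbabilityMeasure_tilted h'
  have hb : 0 < -β := by linarith
  have hi : Integrable (fun x => x) (Q.tilted (fun x => β * x)) :=
    memLp_one_iff_integrable.1 (by exact_mod_cast memLp_tilted_mul h 1)
  have e : ∫ x, (x - a) ∂(Q.tilted (fun x => β * x)) = ∫ x, x ∂(Q.tilted (fun x => β * x)) - a := by
    rw [integral_sub hi (integrable_const a)]; simp
  suffices ∫ x, (x - a) ∂(Q.tilted (fun x => β * x)) ≤ (Q.real {a})⁻¹ * (-β)⁻¹ by linarith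
  rw [integral_tilted]
  calc _ ≤ ∫ x, (Q.real {a})⁻¹ * (-β)⁻¹ ∂Q := by
        refine integral_mono_of_nonneg ?_ (integrable_const _) ?_
        · filter_upwards [hae] with x hx
          have := integral_exp_pos h'
          have : 0 ≤ x - a := by linarith
          simp only [Pi.zero_apply, smul_eq_mul]
          positivity
        · filter_upwards [hae] with x hx
          have hy : 0 ≤ x - a := by linarith
          have e1 := aux_pow 1 (-β * (x - a)) (by linarith) (by positivity)
          have e4 : -(-β * (x - a)) = β * (x - a) := by ring
          rw [e4] at e1
          simp only [Real.rpow_one] at e1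
          simp only [smul_eq_mul]
          calc _ ≤ Real.exp (β * (x - a)) / Q.real {a} * (x - a) := by
                exact mul_le_mul_of_nonneg_right (aux_dens Q a hatom β hh x) hy
            _ = (-β * (x - a) * Real.exp (β * (x - a))) * ((Q.real {a})⁻¹ * (-β)⁻¹) := by
                have : (-β) * (-β)⁻¹ = 1 := mul_inv_cancel₀ hb.ne'
                linear_combination (-(Real.exp (β * (x - a)) / Q.real {a} * (x - a))) * this
            _ ≤ 1 * ((Q.real {a})⁻¹ * (-β)⁻¹) := by gcongr
            _ = _ := by ring
    _ = _ := by simp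

/-- if Q has a point mass at the left end point a of its support
plus, near a, an absolutely continuous part with density (x−a)^{γ−1} g(x), g
analytic, g(a) > 0, then the left end contributes finitely to the Jeffreys
integral in mean-value parametrization. -/
theorem jeffreys_left_end_finite (Q : Measure ℝ) [IsProbabilityMeasure Q]
    (a : ℝ)
    -- a is the left end point of the support of Q
    (hsupp : Q (Iio a) = 0) (hpos : ∀ ε > 0, 0 < Q (Ico a (a + ε)))
    -- absolutely continuous part near a
    (γ : ℝ) (hγ : 0 < γ) (g : ℝ → ℝ) (ε : ℝ) (hε : 0 < ε)
    (hg : AnalyticOn ℝ g (Icc a (a + ε))) (hga : 0 < g a)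
    (hdens : Q.restrict (Ioo a (a + ε)) =
      (volume.withDensity
        (fun x => ENNReal.ofReal ((x - a) ^ (γ - 1) * g x))).restrict
          (Ioo a (a + ε)))
    -- point mass at a
    (hatom : 0 < Q {a})
    -- mean-value parametrization and variance function
    (m V : ℝ → ℝ)
    (hm : ∀ β ∈ interior (Γcan Q), m β = ∫ x, x ∂(Pexp Q β))
    (hV : ∀ β ∈ interior (Γcan Q),
      V (m β) = variance (fun x => x) (Pexp Q β)) :
    ∀ μ₀ ∈ m '' interior (Γcan Q),
      ∫⁻ μ in Ioo a μ₀, ENNReal.ofReal (1 / Real.sqrt (V μ)) < ⊤ := by 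
  rintro _ ⟨β₀, hβ₀, rfl⟩
  rw [aux_canon] at hm hV hβ₀
  set c := cgf (fun x : ℝ => x) Q with hc
  have hmem : ∀ β ≤ β₀, β ∈ interior (integrableExpSet (fun x => x) Q) := fun β hβ =>
    aux_neg_mem Q a hsupp β β₀ hβ hβ₀
  have hmF : ∀ β ∈ interior (integrableExpSet (fun x => x) Q), m β = deriv c β := fun β hβ => by
    rw [hm β hβ, aux_tilt Q β (interior_subset hβ)]
    exact integral_tilted_mul_self hβ
  have hWvar : ∀ β ∈ interior (integrableExpSet (fun x => x) Q),
      deriv (deriv c) β = variance (fun x => x) (Q.tilted (fun x => β * x)) := fun β hβ => by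
    have := variance_tilted_mul hβ
    rw [this, iteratedDeriv_succ, iteratedDeriv_one]
  have hVW : ∀ β ∈ interior (integrableExpSet (fun x => x) Q),
      V (deriv c β) = deriv (deriv c) β := fun β hβ => by
    rw [← hmF β hβ, hV β hβ, hWvar β hβ, aux_tilt Q β (interior_subset hβ)]
  have hW0 : ∀ β ∈ interior (integrableExpSet (fun x => x) Q), 0 ≤ deriv (deriv c) β :=
    fun β hβ => by rw [hWvar β hβ]; exact variance_nonneg _ _
  have hder : ∀ β ∈ interior (integrableExpSet (fun x => x) Q),
      HasDerivAt (deriv c) (deriv (deriv c) β) β := fun β hβ =>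
    (analyticAt_cgf hβ).deriv.differentiableAt.hasDerivAt
  have hWcont : ContinuousOn (deriv (deriv c)) (Iic β₀) := fun β hβ =>
    (analyticAt_cgf (hmem β hβ)).deriv.deriv.continuousAt.continuousWithinAt
  have hFcont : ContinuousOn (deriv c) (Iic β₀) := fun β hβ =>
    (hder β (hmem β hβ)).continuousAt.continuousWithinAt
  have hmono : MonotoneOn (deriv c) (Iic β₀) :=
    monotoneOn_of_hasDerivWithinAt_nonneg (convex_Iic β₀) hFcont
      (fun β hβ => (hder β (hmem β (mem_Iic.1 (interior_subset hβ)))).hasDerivWithinAt)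
      (fun β hβ => hW0 β (hmem β (mem_Iic.1 (interior_subset hβ))))
  have hsub : Ioo a (m β₀) ⊆ deriv c '' Iic β₀ := by
    intro μ hμ
    have ht : Tendsto (fun β : ℝ => a + (Q.real {a})⁻¹ * (-β)⁻¹) atBot (𝓝 a) := by
      have := (tendsto_inv_atTop_zero.comp tendsto_neg_atBot_atTop (β := ℝ)).const_mul
        (Q.real {a})⁻¹
      simpa using this.const_add a
    obtain ⟨β₁, h1, h2, h3⟩ := ((ht.eventually_lt_const hμ.1).and
      ((eventually_lt_atBot (0 : ℝ)).and (eventually_le_atBot β₀))).exists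
    have hlt : deriv c β₁ < μ := by
      rw [← hmF β₁ (hmem β₁ h3), hm β₁ (hmem β₁ h3), aux_tilt Q β₁ (interior_subset (hmem β₁ h3))]
      exact (aux_mean Q a hsupp hatom β₁ h2 (hmem β₁ h3)).trans_lt h1
    have hgt : μ < deriv c β₀ := by rw [← hmF β₀ hβ₀]; exact hμ.2
    obtain ⟨x, hx, hxe⟩ := intermediate_value_Icc h3 (hFcont.mono Icc_subset_Iic_self)
      ⟨hlt.le, hgt.le⟩
    exact ⟨x, hx.2, hxe⟩
  have hint : IntegrableOn (fun β => Real.sqrt (deriv (deriv c) β)) (Iic β₀) := by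
    obtain ⟨C, hC0, hC⟩ := aux_var Q a hsupp hatom (γ / 2) (by linarith)
      (aux_hint Q a hsupp γ hγ g ε hε hg.continuousOn hdens)
    have hsc : ContinuousOn (fun β => Real.sqrt (deriv (deriv c) β)) (Iic β₀) := hWcont.sqrt
    have hb1 : min β₀ (-1) ≤ β₀ := min_le_left _ _
    have hI1 : IntegrableOn (fun β => Real.sqrt (deriv (deriv c) β)) (Icc (min β₀ (-1)) β₀) :=
      (hsc.mono Icc_subset_Iic_self).integrableOn_Icc
    have hI2 : IntegrableOn (fun β => Real.sqrt (deriv (deriv c) β)) (Iio (min β₀ (-1))) := by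
      have h1 : IntegrableOn (fun t : ℝ => t ^ (-(2 + γ / 2) / 2)) (Ioi (-(-1 : ℝ))) :=
        integrableOn_Ioi_rpow_of_lt (by linarith) (by norm_num)
      have h2 := (h1.comp_neg_Iio.mono_set
        (Iio_subset_Iio (min_le_right β₀ (-1)))).const_mul (Real.sqrt C)
      refine h2.mono' ((hsc.mono ?_).aestronglyMeasurable measurableSet_Iio) ?_
      · exact fun x hx => (le_of_lt hx).trans hb1
      · refine (ae_restrict_iff' measurableSet_Iio).2 (ae_of_all _ fun x hx => ?_)
        have hx' : x < min β₀ (-1) := hx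
        have hx1 : x < -1 := hx'.trans_le (min_le_right _ _)
        have hxm := hmem x (hx'.le.trans hb1)
        rw [Real.norm_of_nonneg (Real.sqrt_nonneg _)]
        have := hC x (by linarith) (interior_subset hxm)
        rw [← hWvar x hxm] at this
        refine (Real.sqrt_le_sqrt this).trans_eq ?_
        rw [Real.sqrt_mul hC0, Real.sqrt_eq_rpow ((-x) ^ _), ← Real.rpow_mul (by linarith)]
        congr 2
        ring
    refine (hI2.union hI1).mono_set fun x hx => ?_
    rcases lt_or_ge x (min β₀ (-1)) with h | h
    · exact Or.inl h
    · exact Or.inr ⟨h, hx⟩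
  calc _ ≤ ∫⁻ μ in deriv c '' Iic β₀, ENNReal.ofReal (1 / Real.sqrt (V μ)) :=
        lintegral_mono_set hsub
    _ = ∫⁻ β in Iic β₀, ENNReal.ofReal (deriv (deriv c) β) *
          ENNReal.ofReal (1 / Real.sqrt (V (deriv c β))) :=
        lintegral_image_eq_lintegral_deriv_mul_of_monotoneOn measurableSet_Iic
          (fun β hβ => (hder β (hmem β hβ)).hasDerivWithinAt) hmono _
    _ = ∫⁻ β in Iic β₀, ENNReal.ofReal (Real.sqrt (deriv (deriv c) β)) := by
        refine setLIntegral_congr_fun measurableSet_Iic fun β hβ => ?_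
        have h0 := hW0 β (hmem β hβ)
        rw [hVW β (hmem β hβ), ← ENNReal.ofReal_mul h0, mul_one_div, Real.div_sqrt]
    _ < ⊤ := hint.lintegral_lt_top
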